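/- arXiv:1412.4291 — 5 statements merged into one kernel-verified Lean document; each statement's English description precedes it below -/
import Mathlib

section
/- Let X be a positive random variable whose Laplace transform satisfies E[e^{−λX}] = e^{−c λ^α} for all λ > 0, where c > 0 and α ∈ (0,1). Then for every β with 0 < β < α, E[X^β] = c^{β/α} · Γ(1 − β/α) / Γ(1 − β). -/
open MeasureTheory ProbabilityTheory Filter

noncomputable section

theorem lintegral_rpow_mul_exp_neg_mul_rpow {p q r : ℝ} (hp : 0 < p) (hq : -1 < q) (hr : 0 < r) :
    ∫⁻ x in Set.Ioi (0 : ℝ), ENNReal.ofReal (x ^ q * Real.exp (-r * x ^ p))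
      = ENNReal.ofReal (r ^ (-(q + 1) / p) * (1 / p) * Real.Gamma ((q + 1) / p)) := by
  have h := integral_rpow_mul_exp_neg_mul_rpow hp hq hr
  have hG : 0 < Real.Gamma ((q + 1) / p) := Real.Gamma_pos_of_pos (div_pos (by linarith) hp)
  rw [← h, ofReal_integral_eq_lintegral_ofReal]
  · refine Integrable.of_integral_ne_zero ?_
    rw [h]
    positivity
  · filter_upwards [ae_restrict_mem measurableSet_Ioi] with x hx
    have : (0 : ℝ) < x := hx
    positivity

theorem rpow_mul_Gamma_eq_lintegral {b x : ℝ} (hb : b < 1) (hx : 0 < x) :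
    ∫⁻ l in Set.Ioi (0 : ℝ), ENNReal.ofReal (l ^ (-b) * (x * Real.exp (-l * x)))
      = ENNReal.ofReal (x ^ b) * ENNReal.ofReal (Real.Gamma (1 - b)) := by
  have h := lintegral_rpow_mul_exp_neg_mul_rpow one_pos (show -1 < -b by linarith) hx
  have e : ∀ l : ℝ, ENNReal.ofReal (l ^ (-b) * (x * Real.exp (-l * x)))
      = ENNReal.ofReal x * ENNReal.ofReal (l ^ (-b) * Real.exp (-x * l ^ (1 : ℝ))) := by
    intro l
    rw [← ENNReal.ofReal_mul hx.le, Real.rpow_one]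
    ring_nf
  simp_rw [e]
  rw [lintegral_const_mul' _ _ ENNReal.ofReal_ne_top, h, ← ENNReal.ofReal_mul hx.le,
    ← ENNReal.ofReal_mul (by positivity)]
  have hxb : x ^ b = x * x ^ (-(-b + 1) / 1) := by
    rw [show -(-b + 1) / 1 = b - 1 by ring, Real.rpow_sub_one hx.ne']
    field_simp
  rw [hxb]
  ring_nf

theorem lintegral_mul_exp_of_stable_laplace {Ω : Type*} [MeasurableSpace Ω] (P : Measure Ω)
    [IsProbabilityMeasure P] (X : Ω → ℝ) (hXmeas : Measurable X)
    (hXpos : ∀ᵐ ω ∂P, 0 < X ω) (c a : ℝ)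
    (hlaplace : ∀ l : ℝ, 0 < l →
      ∫ ω, Real.exp (-(l * X ω)) ∂P = Real.exp (-(c * l ^ a))) {l : ℝ} (hl : 0 < l) :
    ∫⁻ ω, ENNReal.ofReal (X ω * Real.exp (-l * X ω)) ∂P
      = ENNReal.ofReal (c * a * l ^ (a - 1) * Real.exp (-c * l ^ a)) := by
  have hsub : Set.Iio (0 : ℝ) ⊆ integrableExpSet X P := by
    intro t ht
    have ht : t < 0 := ht
    refine Integrable.of_bound (C := 1) (by fun_prop) ?_
    filter_upwards [hXpos] with ω hω
    rw [Real.norm_eq_abs, Real.abs_exp, Real.exp_le_one_iff]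
    nlinarith
  have hint : -l ∈ interior (integrableExpSet X P) :=
    interior_maximal hsub isOpen_Iio (by simpa using hl)
  have hd := hasDerivAt_mgf hint
  have hcomp : HasDerivAt (fun s : ℝ => mgf X P (-s))
      (-P[fun ω => X ω * Real.exp (-l * X ω)]) l :=
    (hd.comp l (hasDerivAt_neg l)).congr_deriv (by ring)
  have hexp : HasDerivAt (fun s : ℝ => Real.exp (-(c * s ^ a)))
      (Real.exp (-(c * l ^ a)) * (-(c * (a * l ^ (a - 1))))) l :=
    (((Real.hasDerivAt_rpow_const (Or.inl hl.ne')).const_mul c).neg).exp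
  have heq : (fun s : ℝ => mgf X P (-s)) =ᶠ[nhds l] fun s => Real.exp (-(c * s ^ a)) := by
    filter_upwards [lt_mem_nhds hl] with s hs
    rw [← hlaplace s hs]
    simp [mgf]
  have hval := (hcomp.congr_of_eventuallyEq heq.symm).unique hexp
  have hval' : P[fun ω => X ω * Real.exp (-l * X ω)]
      = c * a * l ^ (a - 1) * Real.exp (-c * l ^ a) := by
    rw [neg_mul c]
    linarith
  rw [← hval', ofReal_integral_eq_lintegral_ofReal]
  · simpa using integrable_pow_mul_exp_of_mem_interior_integrableExpSet hint 1
  · filter_upwards [hXpos] with ω hω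
    positivity

/-- if a positive random variable `X` has Laplace transform
`E[e^{-λX}] = e^{-c λ^α}` for all `λ > 0`, with `c > 0` and `α ∈ (0,1)`, then for every
`0 < β < α` one has `E[X^β] = c^{β/α} Γ(1-β/α)/Γ(1-β)`. -/
theorem moments_of_stable_laplace {Ω : Type*} [MeasurableSpace Ω] (P : Measure Ω)
    [IsProbabilityMeasure P] (X : Ω → ℝ) (hXmeas : Measurable X)
    (hXpos : ∀ᵐ ω ∂P, 0 < X ω) (c a : ℝ) (hc : 0 < c) (ha : a ∈ Set.Ioo (0 : ℝ) 1)
    (hlaplace : ∀ l : ℝ, 0 < l →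
      ∫ ω, Real.exp (-(l * X ω)) ∂P = Real.exp (-(c * l ^ a))) :
    ∀ b : ℝ, 0 < b → b < a →
      ∫⁻ ω, ENNReal.ofReal (X ω ^ b) ∂P
        = ENNReal.ofReal (c ^ (b / a) * Real.Gamma (1 - b / a) / Real.Gamma (1 - b)) := by
  intro b hb hba
  obtain ⟨ha0, ha1⟩ := ha
  have hG : 0 < Real.Gamma (1 - b) := Real.Gamma_pos_of_pos (by linarith)
  have key : (∫⁻ ω, ENNReal.ofReal (X ω ^ b) ∂P) * ENNReal.ofReal (Real.Gamma (1 - b))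
      = ENNReal.ofReal (c ^ (b / a) * Real.Gamma (1 - b / a)) := by
    calc (∫⁻ ω, ENNReal.ofReal (X ω ^ b) ∂P) * ENNReal.ofReal (Real.Gamma (1 - b))
        = ∫⁻ ω, (∫⁻ l in Set.Ioi (0 : ℝ),
            ENNReal.ofReal (l ^ (-b) * (X ω * Real.exp (-l * X ω)))) ∂P := by
          rw [← lintegral_mul_const' _ _ ENNReal.ofReal_ne_top]
          refine lintegral_congr_ae ?_
          filter_upwards [hXpos] with ω hω
          exact (rpow_mul_Gamma_eq_lintegral (by linarith) hω).symm
      _ = ∫⁻ l in Set.Ioi (0 : ℝ), ∫⁻ ω,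
            ENNReal.ofReal (l ^ (-b) * (X ω * Real.exp (-l * X ω))) ∂P :=
          lintegral_lintegral_swap (by fun_prop)
      _ = ∫⁻ l in Set.Ioi (0 : ℝ), ENNReal.ofReal (c * a) *
            ENNReal.ofReal (l ^ (a - 1 - b) * Real.exp (-c * l ^ a)) := by
          refine setLIntegral_congr_fun measurableSet_Ioi fun l hl => ?_
          have hl : 0 < l := hl
          have hlb : 0 ≤ l ^ (-b) := by positivity
          simp only [ENNReal.ofReal_mul hlb]
          rw [lintegral_const_mul' _ _ ENNReal.ofReal_ne_top,
            lintegral_mul_exp_of_stable_laplace P X hXmeas hXpos c a hlaplace hl,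
            ← ENNReal.ofReal_mul hlb, ← ENNReal.ofReal_mul (by positivity),
            sub_eq_add_neg (a - 1) b, Real.rpow_add hl]
          ring_nf
      _ = ENNReal.ofReal (c ^ (b / a) * Real.Gamma (1 - b / a)) := by
          rw [lintegral_const_mul' _ _ ENNReal.ofReal_ne_top,
            lintegral_rpow_mul_exp_neg_mul_rpow ha0 (by linarith) hc,
            ← ENNReal.ofReal_mul (by positivity)]
          have h1 : (a - 1 - b + 1) / a = 1 - b / a := by field_simp; ring
          have h2 : -(a - 1 - b + 1) / a = b / a - 1 := by field_simp; ring
          rw [h1, h2, Real.rpow_sub_one hc.ne']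
          congr 1
          field_simp
  rw [ENNReal.ofReal_div_of_pos hG, ← key, ENNReal.mul_div_cancel_right]
  · simpa using hG
  · exact ENNReal.ofReal_ne_top

end
end

section
/- Let (α_i)_{i≥1} be a strictly increasing sequence in (0,1) with Σ_i (1 − α_i) < ∞, and set d_i := α_i Γ(α_i) Γ(1 − α_i) / Γ(1 − α_i/α_{i+1}). Then Σ_i (1 − α_{i+1})/(1 − α_i) < ∞ if and only if Σ_i (1 − d_i) < ∞. -/
open Filter

noncomputable section

lemma Real.inv_Gamma_one_add_sub_one_isBigO :
    (fun x : ℝ => (Real.Gamma (1 + x))⁻¹ - 1) =O[nhds 0] fun x => x := by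
  have h : DifferentiableAt ℝ (fun x : ℝ => (Real.Gamma (1 + x))⁻¹) 0 := by
    refine DifferentiableAt.inv ?_ (by simp)
    refine DifferentiableAt.comp (g := Real.Gamma) (f := fun x : ℝ => 1 + x) 0 ?_ (by fun_prop)
    exact Real.differentiableAt_Gamma fun m => by
      have : (0 : ℝ) ≤ m := m.cast_nonneg
      linarith
  simpa using h.hasDerivAt.isBigO_sub

lemma Real.Gamma_two_sub_mul_Gamma_one_add_sub_one_isBigO :
    (fun x : ℝ => Real.Gamma (2 - x) * Real.Gamma (1 + x) - 1) =O[nhds 0] fun x => x := by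
  have h : DifferentiableAt ℝ (fun x : ℝ => Real.Gamma (2 - x) * Real.Gamma (1 + x)) 0 := by
    refine DifferentiableAt.mul ?_ ?_
    · refine DifferentiableAt.comp (g := Real.Gamma) (f := fun x : ℝ => 2 - x) 0 ?_ (by fun_prop)
      exact Real.differentiableAt_Gamma fun m => by
        have : (0 : ℝ) ≤ m := m.cast_nonneg
        linarith
    · refine DifferentiableAt.comp (g := Real.Gamma) (f := fun x : ℝ => 1 + x) 0 ?_ (by fun_prop)
      exact Real.differentiableAt_Gamma fun m => by
        have : (0 : ℝ) ≤ m := m.cast_nonneg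
        linarith
  simpa using h.hasDerivAt.isBigO_sub

/-- let `(α_i)` be a strictly increasing sequence in `(0,1)` with
`Σ_i (1-α_i) < ∞`, and `d_i = α_i Γ(α_i) Γ(1-α_i) / Γ(1-α_i/α_{i+1})`. Then
`Σ_i (1-α_{i+1})/(1-α_i) < ∞` iff `Σ_i (1-d_i) < ∞`. -/
theorem summable_ratio_iff_summable_one_sub_d (α : ℕ → ℝ)
    (hmem : ∀ i, α i ∈ Set.Ioo (0 : ℝ) 1) (hmono : StrictMono α)
    (hsum : Summable fun i => 1 - α i) :
    (Summable fun i => (1 - α (i + 1)) / (1 - α i)) ↔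
      Summable fun i =>
        1 - α i * Real.Gamma (α i) * Real.Gamma (1 - α i)
              / Real.Gamma (1 - α i / α (i + 1)) := by
  set f : ℝ → ℝ := fun x => Real.Gamma (2 - x) * Real.Gamma (1 + x) with hf
  set g : ℝ → ℝ := fun x => (Real.Gamma (1 + x))⁻¹ with hg
  set a : ℕ → ℝ := fun i => 1 - α i with ha
  set u : ℕ → ℝ := fun i => 1 - α i / α (i + 1) with hu
  have ha0 : Tendsto a atTop (nhds 0) := hsum.tendsto_atTop_zero
  have hupos : ∀ i, 0 < u i := fun i => by
    have h := (div_lt_one (hmem (i + 1)).1).2 (hmono (Nat.lt_succ_self i))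
    simp only [hu]; linarith
  have hua : ∀ i, u i ≤ a i := fun i => by
    have h : α i ≤ α i / α (i + 1) := by
      rw [le_div_iff₀ (hmem (i + 1)).1]
      nlinarith [(hmem i).1, (hmem (i + 1)).2]
    simp only [hu, ha]; linarith
  have hapos : ∀ i, 0 < a i := fun i => sub_pos.2 (hmem i).2
  have hu0 : Tendsto u atTop (nhds 0) :=
    squeeze_zero (fun i => (hupos i).le) hua ha0
  have huO : u =O[atTop] a := Asymptotics.isBigO_of_le _ fun i => by
    rw [Real.norm_of_nonneg (hupos i).le, Real.norm_of_nonneg (hapos i).le]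
    exact hua i
  have hfO : (fun i => f (a i) - 1) =O[atTop] a :=
    Real.Gamma_two_sub_mul_Gamma_one_add_sub_one_isBigO.comp_tendsto ha0
  have hgO : (fun i => g (u i) - 1) =O[atTop] a :=
    (Real.inv_Gamma_one_add_sub_one_isBigO.comp_tendsto hu0).trans huO
  have hf1 : Tendsto (fun i => f (a i)) atTop (nhds 1) := by
    simpa using (hfO.trans_tendsto ha0).add_const 1
  have hGO : (fun i => 1 - f (a i) * g (u i)) =O[atTop] a := by
    have h := (hf1.isBigO_one ℝ).mul hgO
    simp only [one_mul] at h
    exact (h.add hfO).neg_left.congr_left fun i => by ring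
  have hG1 : Tendsto (fun i => f (a i) * g (u i)) atTop (nhds 1) := by
    simpa using (hGO.trans_tendsto ha0).const_sub 1
  have hGsum : Summable fun i => 1 - f (a i) * g (u i) := summable_of_isBigO_nat hsum hGO
  have hc : Tendsto (fun i => f (a i) * g (u i) * (α i / α (i + 1))) atTop (nhds 1) := by
    have h := hG1.mul (hu0.const_sub 1)
    simpa [hu] using h
  have hequiv : Asymptotics.IsEquivalent atTop
      (fun i => f (a i) * g (u i) * (α i / α (i + 1)) * ((1 - α (i + 1)) / (1 - α i)))
      (fun i => (1 - α (i + 1)) / (1 - α i)) :=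
    Asymptotics.isEquivalent_iff_exists_eq_mul.2 ⟨_, hc, Eventually.of_forall fun i => rfl⟩
  have key : ∀ i, 1 - α i * Real.Gamma (α i) * Real.Gamma (1 - α i)
        / Real.Gamma (1 - α i / α (i + 1)) = (1 - f (a i) * g (u i)) +
      f (a i) * g (u i) * (α i / α (i + 1)) * ((1 - α (i + 1)) / (1 - α i)) := fun i => by
    have hα := (hmem i).1.ne'
    have hα' := (hmem (i + 1)).1.ne'
    have hane : 1 - α i ≠ 0 := (hapos i).ne'
    have hune : 1 - α i / α (i + 1) ≠ 0 := (hupos i).ne'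
    have h1 : Real.Gamma (2 - (1 - α i)) = α i * Real.Gamma (α i) := by
      rw [← Real.Gamma_add_one hα]; ring_nf
    have h2 : Real.Gamma (1 + (1 - α i)) = (1 - α i) * Real.Gamma (1 - α i) := by
      rw [← Real.Gamma_add_one hane]; ring_nf
    have h3 : Real.Gamma (1 + (1 - α i / α (i + 1)))
        = (1 - α i / α (i + 1)) * Real.Gamma (1 - α i / α (i + 1)) := by
      rw [← Real.Gamma_add_one hune]; ring_nf
    have hratio : 1 - α i / α (i + 1) * ((1 - α (i + 1)) / (1 - α i))
        = (1 - α i / α (i + 1)) / (1 - α i) := by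
      field_simp
      ring
    have hfg : f (a i) * g (u i) * ((1 - α i / α (i + 1)) / (1 - α i))
        = α i * Real.Gamma (α i) * Real.Gamma (1 - α i) / Real.Gamma (1 - α i / α (i + 1)) := by
      simp only [hf, hg, ha, hu, h1, h2, h3]
      generalize 1 - α i / α (i + 1) = v at hune ⊢
      rw [mul_inv]
      field_simp
    rw [← hfg, ← hratio]
    ring
  rw [← hequiv.summable_iff_nat, summable_congr key]
  exact ⟨hGsum.add, fun h => by simpa using h.sub hGsum⟩

end
end

section
/- Let (α_i)_{i≥1} be a strictly increasing sequence in (0,1) with Σ_i (1 − α_{i+1})/(1 − α_i) < ∞ (which entails Σ_i (1 − α_i) < ∞). Then, with d_i := α_i Γ(α_i) Γ(1 − α_i) / Γ(1 − α_i/α_{i+1}) ∈ (0,1), the infinite product ∏_{i=1}^∞ d_i converges to a strictly positive limit, i.e. inf_n ∏_{i=1}^n d_i > 0. -/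
open Filter

noncomputable section

/-- Finite products `∏ (1 - u i)` stay away from zero when `u` is summable with values in
`[0, 1)`. -/
theorem exists_pos_le_prod_one_sub {u : ℕ → ℝ} (hu : Summable u) (h0 : ∀ i, 0 ≤ u i)
    (h1 : ∀ i, u i < 1) : ∃ c : ℝ, 0 < c ∧ ∀ n, c ≤ ∏ i ∈ Finset.range n, (1 - u i) := by
  have hlog : Summable fun i => Real.log (1 - u i) := by
    simpa [sub_eq_add_neg] using Real.summable_log_one_add_of_summable hu.neg
  refine ⟨Real.exp (∑' i, Real.log (1 - u i)), Real.exp_pos _, fun n => ?_⟩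
  have hprod : ∏ i ∈ Finset.range n, (1 - u i)
      = Real.exp (∑ i ∈ Finset.range n, Real.log (1 - u i)) := by
    rw [Real.exp_sum]
    exact Finset.prod_congr rfl fun i _ => (Real.exp_log (by linarith [h1 i])).symm
  rw [hprod, Real.exp_le_exp]
  have h := hlog.neg.sum_le_tsum (Finset.range n) fun i _ => by
    have := Real.log_nonpos (by linarith [h1 i] : 0 ≤ 1 - u i) (by linarith [h0 i])
    linarith
  rw [tsum_neg, Finset.sum_neg_distrib] at h
  linarith

theorem Gamma_le_one_of_mem_Icc {x : ℝ} (hx : x ∈ Set.Icc (1 : ℝ) 2) : Real.Gamma x ≤ 1 := by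
  have h := Real.convexOn_Gamma.le_max_of_mem_Icc (x := 1) (y := 2) (by simp) (by simp) hx
  simpa [Real.Gamma_two] using h

/-- The reflection formula and `sin y ≤ y` bound `Γ(a) Γ(1 - a)` from below. -/
theorem inv_one_sub_le_Gamma_mul_Gamma_one_sub {a : ℝ} (ha : a ∈ Set.Ioo (0 : ℝ) 1) :
    (1 - a)⁻¹ ≤ Real.Gamma a * Real.Gamma (1 - a) := by
  have hpos : 0 < 1 - a := by linarith [ha.2]
  have hπ := Real.pi_pos
  have hsin : Real.sin (Real.pi * a) ≤ Real.pi * (1 - a) := by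
    have h := Real.sin_le (x := Real.pi * (1 - a)) (by positivity)
    rwa [mul_sub, mul_one, Real.sin_pi_sub, ← mul_one_sub] at h
  have hsin_pos : 0 < Real.sin (Real.pi * a) :=
    Real.sin_pos_of_pos_of_lt_pi (mul_pos hπ ha.1) (by nlinarith [ha.2])
  rw [Real.Gamma_mul_Gamma_one_sub, inv_eq_one_div, div_le_div_iff₀ hpos hsin_pos]
  linarith

theorem mul_one_sub_div_le_Gamma_quotient {a b : ℝ} (ha : 0 < a) (hab : a < b) (hb : b < 1) :
    (1 - (1 - a)) * (1 - (1 - b) / (1 - a))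
      ≤ a * Real.Gamma a * Real.Gamma (1 - a) / Real.Gamma (1 - a / b) := by
  have hb0 : 0 < b := ha.trans hab
  have hpos : 0 < 1 - a := by linarith
  have hdiv : a / b < 1 := (div_lt_one hb0).2 hab
  have hdiv0 : 0 < a / b := div_pos ha hb0
  have hx : 0 < 1 - a / b := by linarith
  have hG : 0 < Real.Gamma (1 - a / b) := Real.Gamma_pos_of_pos hx
  have hle : (1 - a / b) * Real.Gamma (1 - a / b) ≤ 1 := by
    rw [← Real.Gamma_add_one hx.ne']
    exact Gamma_le_one_of_mem_Icc ⟨by linarith, by linarith⟩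
  have hnum : 1 - (1 - b) / (1 - a) ≤ (1 - a / b) * (1 - a)⁻¹ := by
    have h1 : 1 - (1 - b) / (1 - a) = (b - a) * (1 - a)⁻¹ := by field_simp; ring
    have h2 : b - a ≤ 1 - a / b := by
      rw [one_sub_div hb0.ne', le_div_iff₀ hb0]
      nlinarith
    rw [h1]
    gcongr
  rw [le_div_iff₀ hG, sub_sub_cancel]
  calc a * (1 - (1 - b) / (1 - a)) * Real.Gamma (1 - a / b)
      ≤ a * ((1 - a / b) * (1 - a)⁻¹) * Real.Gamma (1 - a / b) := by gcongr
    _ = a * (1 - a)⁻¹ * ((1 - a / b) * Real.Gamma (1 - a / b)) := by ring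
    _ ≤ a * (1 - a)⁻¹ * 1 := by gcongr
    _ ≤ a * (Real.Gamma a * Real.Gamma (1 - a)) := by
        rw [mul_one]
        gcongr
        exact inv_one_sub_le_Gamma_mul_Gamma_one_sub ⟨ha, by linarith⟩
    _ = a * Real.Gamma a * Real.Gamma (1 - a) := by ring

/-- let `(α_i)` be a strictly increasing sequence in `(0,1)` with
`Σ_i (1-α_{i+1})/(1-α_i) < ∞`, and `d_i = α_i Γ(α_i) Γ(1-α_i) / Γ(1-α_i/α_{i+1}) ∈ (0,1)`.
Then the infinite product `∏ d_i` has a strictly positive limit, i.e.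
`inf_n ∏_{i<n} d_i > 0`. -/
theorem prod_d_pos (α : ℕ → ℝ)
    (hmem : ∀ i, α i ∈ Set.Ioo (0 : ℝ) 1) (hmono : StrictMono α)
    (hsum : Summable fun i => (1 - α (i + 1)) / (1 - α i)) :
    0 < ⨅ n : ℕ, ∏ i ∈ Finset.range n,
      α i * Real.Gamma (α i) * Real.Gamma (1 - α i)
        / Real.Gamma (1 - α i / α (i + 1)) := by
  have h0 : ∀ i, 0 < α i := fun i => (hmem i).1
  have hpos : ∀ i, 0 < 1 - α i := fun i => sub_pos.2 (hmem i).2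
  have hlt : ∀ i, α i < α (i + 1) := fun i => hmono i.lt_succ_self
  have hratio : ∀ i, (1 - α (i + 1)) / (1 - α i) < 1 := fun i =>
    (div_lt_one (hpos i)).2 (by linarith [hlt i])
  have hsum' : Summable fun i => 1 - α i := by
    refine (summable_nat_add_iff 1).1 (hsum.of_nonneg_of_le (fun i => (hpos (i + 1)).le) ?_)
    exact fun i => le_div_self (hpos (i + 1)).le (hpos i) (by linarith [h0 i])
  obtain ⟨c, hc, hcle⟩ := exists_pos_le_prod_one_sub hsum' (fun i => (hpos i).le)
    (fun i => by linarith [h0 i])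
  obtain ⟨e, he, hele⟩ := exists_pos_le_prod_one_sub hsum
    (fun i => (div_pos (hpos (i + 1)) (hpos i)).le) hratio
  refine (mul_pos hc he).trans_le (le_ciInf fun n => ?_)
  refine (mul_le_mul (hcle n) (hele n) he.le (hc.le.trans (hcle n))).trans ?_
  rw [← Finset.prod_mul_distrib]
  refine Finset.prod_le_prod (fun i _ => ?_) fun i _ =>
    mul_one_sub_div_le_Gamma_quotient (h0 i) (hlt i) (hmem (i + 1)).2
  exact mul_nonneg (by linarith [h0 i]) (sub_nonneg.2 (hratio i).le)

end
end

section
/- Let (α_i)_{i≥1} be a strictly increasing sequence in (0,1) with Σ_i (1 − α_i) < ∞ and Σ_i (1 − α_{i+1})/(1 − α_i) = ∞. Set d_i := α_i Γ(α_i) Γ(1 − α_i) / Γ(1 − α_i/α_{i+1}) ∈ (0,1) and e_i := ∏_{j=1}^{i−1} α_j (with e_1 := 1). Then ∏_{i=1}^{n} d_i^{e_i} → 0 as n → ∞. -/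
open Filter

noncomputable section

theorem Real.Gamma_le_one_of_mem_Icc {t : ℝ} (ht : t ∈ Set.Icc (1 : ℝ) 2) :
    Real.Gamma t ≤ 1 := by
  have h := Real.convexOn_Gamma.2 (Set.mem_Ioi.2 (one_pos : (0 : ℝ) < 1))
    (Set.mem_Ioi.2 (two_pos : (0 : ℝ) < 2)) (sub_nonneg.2 ht.2 : 0 ≤ 2 - t)
    (sub_nonneg.2 ht.1 : 0 ≤ t - 1) (by ring)
  have h2 : (2 - t) • (1 : ℝ) + (t - 1) • (2 : ℝ) = t := by simp only [smul_eq_mul]; ring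
  rw [h2] at h
  simp only [Real.Gamma_one, Real.Gamma_two, smul_eq_mul] at h
  linarith

theorem Real.inv_Gamma_one_add_le_exp {u : ℝ} (hu : 0 ≤ u) :
    (Real.Gamma (1 + u))⁻¹ ≤ Real.exp u := by
  have h1 : 1 ≤ Real.Gamma (1 + u + 1) := by
    have h2 : 2 ≤ 1 + u + 1 := by linarith
    exact Real.Gamma_two.symm.le.trans <|
      Real.Gamma_strictMonoOn_Ici.monotoneOn Set.self_mem_Ici h2 h2
  rw [Real.Gamma_add_one (by positivity)] at h1
  have hG : 0 < Real.Gamma (1 + u) := Real.Gamma_pos_of_pos (by positivity)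
  rw [inv_le_iff_one_le_mul₀ hG]
  nlinarith [Real.add_one_le_exp u]

theorem Real.inv_le_exp_one_sub_div {c b : ℝ} (hc : 0 < c) (hcb : c ≤ b) (hb : b ≤ 1) :
    b⁻¹ ≤ Real.exp ((1 - b) / c) := by
  have hb0 : 0 < b := hc.trans_le hcb
  have h1 : b⁻¹ = (1 - b) / b + 1 := by field_simp; ring
  calc b⁻¹ ≤ Real.exp ((1 - b) / b) := h1 ▸ Real.add_one_le_exp _
    _ ≤ Real.exp ((1 - b) / c) := by
      gcongr

theorem Gamma_ratio_eq {a b : ℝ} (ha : 0 < a) (hab : a < b) (hb : b < 1) :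
    a * Real.Gamma a * Real.Gamma (1 - a) / Real.Gamma (1 - a / b)
      = (1 - (1 - b) / (1 - a)) *
        (Real.Gamma (a + 1) * Real.Gamma (2 - a)) * (b⁻¹ * (Real.Gamma (1 + (1 - a / b)))⁻¹) := by
  have hb0 : 0 < b := ha.trans hab
  have ha1 : 0 < 1 - a := by linarith
  have hu : 0 < 1 - a / b := by rw [sub_pos, div_lt_one hb0]; exact hab
  have hG := (Real.Gamma_pos_of_pos hu).ne'
  have h2 : (2 : ℝ) - a = (1 - a) + 1 := by ring
  rw [Real.Gamma_add_one ha.ne', h2, Real.Gamma_add_one ha1.ne', add_comm 1 (1 - a / b),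
    Real.Gamma_add_one hu.ne']
  have h3 : 1 - (1 - b) / (1 - a) = b * (1 - a / b) / (1 - a) := by
    field_simp
    ring
  rw [h3]
  generalize 1 - a / b = u at *
  field_simp

theorem Gamma_ratio_nonneg {a b : ℝ} (ha : 0 < a) (hab : a < b) (hb : b < 1) :
    0 ≤ a * Real.Gamma a * Real.Gamma (1 - a) / Real.Gamma (1 - a / b) := by
  have hu : 0 < 1 - a / b := by rw [sub_pos, div_lt_one (ha.trans hab)]; exact hab
  have h1 := Real.Gamma_pos_of_pos ha
  have h2 := Real.Gamma_pos_of_pos (s := 1 - a) (by linarith)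
  have h3 := Real.Gamma_pos_of_pos hu
  positivity

theorem Gamma_ratio_le_exp {a b c : ℝ} (hc : 0 < c) (hca : c ≤ a) (hab : a < b) (hb : b < 1) :
    a * Real.Gamma a * Real.Gamma (1 - a) / Real.Gamma (1 - a / b)
      ≤ Real.exp (-((1 - b) / (1 - a)) + (1 + c⁻¹) * (1 - a)) := by
  have ha : 0 < a := hc.trans_le hca
  have hb0 : 0 < b := ha.trans hab
  have ha1 : 0 < 1 - a := by linarith
  have hu : 0 < 1 - a / b := by rw [sub_pos, div_lt_one hb0]; exact hab
  have hua : 1 - a / b ≤ 1 - a := by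
    have : a ≤ a / b := by rw [le_div_iff₀ hb0]; nlinarith
    linarith
  have hr : (1 - b) / (1 - a) < 1 := by rw [div_lt_one ha1]; linarith
  have hG1 := Real.Gamma_pos_of_pos (s := a + 1) (by linarith)
  have hG2 := Real.Gamma_pos_of_pos (s := 2 - a) (by linarith)
  have hG3 := Real.Gamma_pos_of_pos (s := 1 + (1 - a / b)) (by linarith)
  have hexp : Real.exp (-((1 - b) / (1 - a)) + (1 + c⁻¹) * (1 - a))
      = Real.exp (-((1 - b) / (1 - a))) * 1 *
        (Real.exp ((1 - a) / c) * Real.exp (1 - a)) := by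
    rw [mul_one, ← Real.exp_add, ← Real.exp_add]
    congr 1
    ring
  rw [Gamma_ratio_eq ha hab hb, hexp]
  have h1 : 1 - (1 - b) / (1 - a) ≤ Real.exp (-((1 - b) / (1 - a))) := Real.one_sub_le_exp_neg _
  have h2 : Real.Gamma (a + 1) * Real.Gamma (2 - a) ≤ 1 :=
    mul_le_one₀ (Real.Gamma_le_one_of_mem_Icc ⟨by linarith, by linarith⟩) hG2.le
      (Real.Gamma_le_one_of_mem_Icc ⟨by linarith, by linarith⟩)
  have h3 : b⁻¹ ≤ Real.exp ((1 - a) / c) :=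
    (Real.inv_le_exp_one_sub_div hc (hca.trans hab.le) hb.le).trans (by gcongr)
  have h4 : (Real.Gamma (1 + (1 - a / b)))⁻¹ ≤ Real.exp (1 - a) :=
    (Real.inv_Gamma_one_add_le_exp hu.le).trans (Real.exp_le_exp.2 hua)
  gcongr

/-- The partial products of factors in `[c, 1]` with summable defect are bounded below. -/
theorem exp_neg_tsum_div_le_prod {α : ℕ → ℝ} {c : ℝ} (hc : 0 < c) (hcα : ∀ i, c ≤ α i)
    (hα : ∀ i, α i ≤ 1) (hsum : Summable fun i => 1 - α i) (n : ℕ) :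
    Real.exp (-((∑' i, (1 - α i)) / c)) ≤ ∏ j ∈ Finset.range n, α j := by
  calc Real.exp (-((∑' i, (1 - α i)) / c))
      ≤ Real.exp (∑ j ∈ Finset.range n, -((1 - α j) / c)) := by
        rw [Finset.sum_neg_distrib, ← Finset.sum_div]
        gcongr
        exact hsum.sum_le_tsum _ fun i _ => sub_nonneg.2 (hα i)
    _ = ∏ j ∈ Finset.range n, Real.exp (-((1 - α j) / c)) := Real.exp_sum _ _
    _ ≤ ∏ j ∈ Finset.range n, α j := by
        refine Finset.prod_le_prod (fun _ _ => (Real.exp_pos _).le) fun j _ => ?_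
        rw [Real.exp_neg]
        exact inv_le_of_inv_le₀ (hc.trans_le (hcα j))
          (Real.inv_le_exp_one_sub_div hc (hcα j) (hα j))

/-- let `(α_i)` be strictly increasing in `(0,1)` with `Σ_i (1-α_i) < ∞`
and `Σ_i (1-α_{i+1})/(1-α_i) = ∞`. With `d_i = α_i Γ(α_i) Γ(1-α_i)/Γ(1-α_i/α_{i+1})`
and `e_i = ∏_{j<i} α_j` (`e` of the first index being `1`), one has
`∏_{i<n} d_i ^ e_i → 0` as `n → ∞`. -/
theorem prod_d_pow_e_tendsto_zero (α : ℕ → ℝ)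
    (hmem : ∀ i, α i ∈ Set.Ioo (0 : ℝ) 1) (hmono : StrictMono α)
    (hsum : Summable fun i => 1 - α i)
    (hdiv : ¬ Summable fun i => (1 - α (i + 1)) / (1 - α i)) :
    Tendsto
      (fun n => ∏ i ∈ Finset.range n,
        (α i * Real.Gamma (α i) * Real.Gamma (1 - α i)
            / Real.Gamma (1 - α i / α (i + 1)))
          ^ (∏ j ∈ Finset.range i, α j))
      atTop (nhds 0) := by
  have hc : 0 < α 0 := (hmem 0).1
  have hcα : ∀ i, α 0 ≤ α i := fun i => hmono.monotone (Nat.zero_le i)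
  have hx : ∀ i, 0 < 1 - α i := fun i => sub_pos.2 (hmem i).2
  have hr : ∀ i, 0 ≤ (1 - α (i + 1)) / (1 - α i) := fun i => (div_pos (hx _) (hx i)).le
  have hlt : ∀ i, α i < α (i + 1) := fun i => hmono i.lt_succ_self
  set S := ∑' i, (1 - α i) with hS
  set k := Real.exp (-(S / α 0)) with hk
  have hk0 : 0 < k := Real.exp_pos _
  have hC : 0 ≤ 1 + (α 0)⁻¹ := by positivity
  have hdivT : Tendsto (fun n => ∑ i ∈ Finset.range n, (1 - α (i + 1)) / (1 - α i)) atTop atTop :=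
    (not_summable_iff_tendsto_nat_atTop_of_nonneg hr).1 hdiv
  have hlim : Tendsto (fun n => Real.exp
      (-(k * ∑ i ∈ Finset.range n, (1 - α (i + 1)) / (1 - α i)) + (1 + (α 0)⁻¹) * S))
      atTop (nhds 0) :=
    Real.tendsto_exp_atBot.comp <| tendsto_atBot_add_const_right _ _ <|
      tendsto_neg_atTop_atBot.comp (hdivT.const_mul_atTop hk0)
  have hd0 := fun i => Gamma_ratio_nonneg (hmem i).1 (hlt i) (hmem (i + 1)).2
  refine squeeze_zero (fun n => Finset.prod_nonneg fun i _ => Real.rpow_nonneg (hd0 i) _)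
    (fun n => ?_) hlim
  have hterm : ∀ i, (α i * Real.Gamma (α i) * Real.Gamma (1 - α i)
      / Real.Gamma (1 - α i / α (i + 1))) ^ (∏ j ∈ Finset.range i, α j)
      ≤ Real.exp (-(k * ((1 - α (i + 1)) / (1 - α i))) + (1 + (α 0)⁻¹) * (1 - α i)) := by
    intro i
    have he0 : k ≤ ∏ j ∈ Finset.range i, α j :=
      exp_neg_tsum_div_le_prod hc hcα (fun i => (hmem i).2.le) hsum i
    have he1 : ∏ j ∈ Finset.range i, α j ≤ 1 :=
      Finset.prod_le_one (fun j _ => (hmem j).1.le) fun j _ => (hmem j).2.le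
    refine (Real.rpow_le_rpow (hd0 i)
      (Gamma_ratio_le_exp hc (hcα i) (hlt i) (hmem (i + 1)).2) (hk0.le.trans he0)).trans ?_
    rw [← Real.exp_mul, Real.exp_le_exp]
    have h1 := mul_le_mul_of_nonneg_right he0 (hr i)
    have h2 := mul_le_mul_of_nonneg_right he1 (mul_nonneg hC (hx i).le)
    linarith
  refine (Finset.prod_le_prod (fun i _ => Real.rpow_nonneg (hd0 i) _) fun i _ => hterm i).trans ?_
  rw [← Real.exp_sum, Real.exp_le_exp, Finset.sum_add_distrib, Finset.sum_neg_distrib,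
    ← Finset.mul_sum, ← Finset.mul_sum]
  gcongr
  exact hsum.sum_le_tsum _ fun i _ => (hx i).le

end
end

section
/- Let (α_k)_{k≥1} be a strictly increasing sequence in (0,1) such that (1 − α_{k+1})/(1 − α_k) → 0 as k → ∞. For each k let W_k be a positive random variable with Laplace transform E[e^{−λ W_k}] = exp{−λ^{α_{k+1}}} for all λ > 0 (an α_{k+1}-stable random variable). Then E[ |W_k − 1|^{α_k} ] → 0 as k → ∞. -/
open MeasureTheory ProbabilityTheory Filter ENNReal

noncomputable section

lemma sub_sq_div_two_le_one_sub_exp_neg {x : ℝ} (hx : 0 ≤ x) :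
    x - x ^ 2 / 2 ≤ 1 - Real.exp (-x) := by
  have h := Real.quadratic_le_exp_of_nonneg hx
  have h1 : Real.exp (-x) * Real.exp x = 1 := by rw [← Real.exp_add]; simp
  have h2 : Real.exp (-x) * (1 + x + x ^ 2 / 2) ≤ 1 := by
    exact (mul_le_mul_of_nonneg_left h (Real.exp_nonneg _)).trans_eq h1
  have h3 : 1 ≤ (1 - x + x ^ 2 / 2) * (1 + x + x ^ 2 / 2) := by
    nlinarith [sq_nonneg (x ^ 2)]
  have h4 : 0 < 1 + x + x ^ 2 / 2 := by positivity
  have := le_of_mul_le_mul_right (h2.trans h3) h4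
  linarith

lemma ofReal_mul_rpow_le_lintegral_one_sub_exp {a w : ℝ} (ha : a ∈ Set.Ioo (0 : ℝ) 1)
    (hw : 0 < w) :
    ENNReal.ofReal ((1 / (1 - a) - 1 / 2) * w ^ a) ≤
      ∫⁻ l in Set.Ioi (0 : ℝ), ENNReal.ofReal ((1 - Real.exp (-(l * w))) * l ^ (-a - 1)) := by
  obtain ⟨ha0, ha1⟩ := ha
  have hiw : 0 < w⁻¹ := inv_pos.2 hw
  have i1 : IntervalIntegrable (fun l : ℝ => l ^ (-a)) volume 0 w⁻¹ :=
    intervalIntegral.intervalIntegrable_rpow' (by linarith)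
  have i2 : IntervalIntegrable (fun l : ℝ => l ^ (1 - a)) volume 0 w⁻¹ :=
    intervalIntegral.intervalIntegrable_rpow' (by linarith)
  have i3 : IntervalIntegrable (fun l : ℝ => w * l ^ (-a) - w ^ 2 / 2 * l ^ (1 - a))
      volume 0 w⁻¹ := (i1.const_mul _).sub (i2.const_mul _)
  have hint : ∫ l in (0 : ℝ)..w⁻¹, (w * l ^ (-a) - w ^ 2 / 2 * l ^ (1 - a)) =
      (1 / (1 - a) - 1 / (2 * (2 - a))) * w ^ a := by
    rw [intervalIntegral.integral_sub (i1.const_mul _) (i2.const_mul _),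
      intervalIntegral.integral_const_mul, intervalIntegral.integral_const_mul,
      integral_rpow (Or.inl (by linarith)), integral_rpow (Or.inl (by linarith)),
      Real.zero_rpow (by linarith), Real.zero_rpow (by linarith),
      Real.inv_rpow hw.le, Real.inv_rpow hw.le, ← Real.rpow_neg hw.le, ← Real.rpow_neg hw.le]
    have e1 : w ^ (-(-a + 1)) = w ^ a / w := by
      rw [show -(-a + 1) = a - 1 by ring, Real.rpow_sub_one hw.ne']
    have e2 : w ^ (-(1 - a + 1)) = w ^ a / w ^ 2 := by
      rw [show -(1 - a + 1) = a - (2 : ℕ) by push_cast; ring, Real.rpow_sub_natCast hw.ne']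
    rw [e1, e2]
    have h1 : 1 - a ≠ 0 := by linarith
    have h2 : 2 - a ≠ 0 := by linarith
    rw [show -a + 1 = 1 - a by ring, show 1 - a + 1 = 2 - a by ring]
    field_simp
    ring
  have hcomp : ∀ l ∈ Set.Ioc 0 w⁻¹, w * l ^ (-a) - w ^ 2 / 2 * l ^ (1 - a) =
      (l * w - (l * w) ^ 2 / 2) * l ^ (-a - 1) := by
    intro l hl
    have hl0 : 0 < l := hl.1
    rw [Real.rpow_sub_one hl0.ne', show 1 - a = -a + 1 by ring, Real.rpow_add_one hl0.ne']
    field_simp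
  have hnn : ∀ l ∈ Set.Ioc 0 w⁻¹, 0 ≤ w * l ^ (-a) - w ^ 2 / 2 * l ^ (1 - a) := by
    intro l hl
    rw [hcomp l hl]
    have hl0 : 0 < l := hl.1
    have : l * w ≤ 1 := by
      calc l * w ≤ w⁻¹ * w := by gcongr; exact hl.2
        _ = 1 := inv_mul_cancel₀ hw.ne'
    have h0 : 0 ≤ l * w := by positivity
    apply mul_nonneg _ (by positivity)
    nlinarith
  calc ENNReal.ofReal ((1 / (1 - a) - 1 / 2) * w ^ a)
      ≤ ENNReal.ofReal ((1 / (1 - a) - 1 / (2 * (2 - a))) * w ^ a) := by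
        gcongr
        linarith
    _ = ∫⁻ l in Set.Ioc 0 w⁻¹,
          ENNReal.ofReal (w * l ^ (-a) - w ^ 2 / 2 * l ^ (1 - a)) := by
        rw [← hint, intervalIntegral.integral_of_le hiw.le, ofReal_integral_eq_lintegral_ofReal]
        · exact (intervalIntegrable_iff_integrableOn_Ioc_of_le hiw.le).1 i3
        · exact (ae_restrict_iff' measurableSet_Ioc).2 (ae_of_all _ hnn)
    _ ≤ ∫⁻ l in Set.Ioc 0 w⁻¹, ENNReal.ofReal ((1 - Real.exp (-(l * w))) * l ^ (-a - 1)) := by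
        apply setLIntegral_mono' measurableSet_Ioc
        intro l hl
        rw [hcomp l hl]
        have hl0 : 0 < l := hl.1
        exact ENNReal.ofReal_le_ofReal (mul_le_mul_of_nonneg_right
          (sub_sq_div_two_le_one_sub_exp_neg (by positivity)) (by positivity))
    _ ≤ _ := lintegral_mono_set Set.Ioc_subset_Ioi_self

lemma lintegral_one_sub_exp_rpow_le {a b : ℝ} (ha : 0 < a) (hab : a < b) :
    ∫⁻ l in Set.Ioi (0 : ℝ), ENNReal.ofReal ((1 - Real.exp (-(l ^ b))) * l ^ (-a - 1)) ≤
      ENNReal.ofReal (1 / (b - a) + 1 / a) := by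
  rw [← Set.Ioc_union_Ioi_eq_Ioi (zero_le_one' ℝ),
    lintegral_union measurableSet_Ioi Set.Ioc_disjoint_Ioi_same,
    ENNReal.ofReal_add (by have := sub_pos.2 hab; positivity) (by positivity)]
  gcongr
  · have hI : IntervalIntegrable (fun l : ℝ => l ^ (b - a - 1)) volume 0 1 :=
      intervalIntegral.intervalIntegrable_rpow' (by linarith)
    have hint : ∫ l in (0 : ℝ)..1, l ^ (b - a - 1) = 1 / (b - a) := by
      rw [integral_rpow (Or.inl (by linarith)), Real.zero_rpow (by linarith)]
      simp
    rw [← hint, intervalIntegral.integral_of_le zero_le_one, ofReal_integral_eq_lintegral_ofReal]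
    · apply setLIntegral_mono' measurableSet_Ioc
      intro l hl
      have hl0 : 0 < l := hl.1
      rw [show b - a - 1 = b + (-a - 1) by ring, Real.rpow_add hl0]
      gcongr
      linarith [Real.add_one_le_exp (-(l ^ b))]
    · exact (intervalIntegrable_iff_integrableOn_Ioc_of_le zero_le_one).1 hI
    · refine (ae_restrict_iff' measurableSet_Ioc).2 (ae_of_all _ fun l hl => ?_)
      exact Real.rpow_nonneg hl.1.le _
  · have hint : ∫ l in Set.Ioi (1 : ℝ), l ^ (-a - 1) = 1 / a := by
      rw [integral_Ioi_rpow_of_lt (by linarith) zero_lt_one]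
      simp [neg_div_neg_eq]
    rw [← hint, ofReal_integral_eq_lintegral_ofReal]
    · apply setLIntegral_mono' measurableSet_Ioi
      intro l hl
      have hl0 : (0 : ℝ) < l := zero_lt_one.trans hl
      have := Real.exp_pos (-(l ^ b))
      have h2 : 0 < l ^ (-a - 1) := by positivity
      gcongr
      nlinarith
    · exact integrableOn_Ioi_rpow_of_lt (by linarith) zero_lt_one
    · refine (ae_restrict_iff' measurableSet_Ioi).2 (ae_of_all _ fun l hl => ?_)
      exact Real.rpow_nonneg (zero_le_one.trans (le_of_lt hl)) _

section Stable

variable {Ω : Type*} [MeasurableSpace Ω] {P : Measure Ω} [IsProbabilityMeasure P]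
  {a b : ℝ} {X : Ω → ℝ}

lemma integrable_exp_neg_mul_of_pos (hX : Measurable X) (hpos : ∀ᵐ ω ∂P, 0 < X ω) {l : ℝ}
    (hl : 0 < l) : Integrable (fun ω => Real.exp (-(l * X ω))) P := by
  refine Integrable.of_bound (C := 1) (by fun_prop) ?_
  filter_upwards [hpos] with ω h
  rw [Real.norm_eq_abs, Real.abs_exp, Real.exp_le_one_iff]
  have : 0 < l * X ω := by positivity
  linarith

lemma ofReal_mul_lintegral_rpow_le_of_stable (ha : a ∈ Set.Ioo (0 : ℝ) 1) (hab : a < b)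
    (hX : Measurable X) (hpos : ∀ᵐ ω ∂P, 0 < X ω)
    (hlap : ∀ l : ℝ, 0 < l → ∫ ω, Real.exp (-(l * X ω)) ∂P = Real.exp (-(l ^ b))) :
    ENNReal.ofReal (1 / (1 - a) - 1 / 2) * ∫⁻ ω, ENNReal.ofReal (X ω ^ a) ∂P ≤
      ENNReal.ofReal (1 / (b - a) + 1 / a) := by
  have hc : 0 ≤ 1 / (1 - a) - 1 / 2 := by
    have : 1 ≤ 1 / (1 - a) := by
      rw [le_div_iff₀ (by linarith [ha.2])]; linarith [ha.1]
    linarith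
  calc ENNReal.ofReal (1 / (1 - a) - 1 / 2) * ∫⁻ ω, ENNReal.ofReal (X ω ^ a) ∂P
      = ∫⁻ ω, ENNReal.ofReal ((1 / (1 - a) - 1 / 2) * X ω ^ a) ∂P := by
        rw [← lintegral_const_mul _ (by fun_prop)]
        simp_rw [ENNReal.ofReal_mul hc]
    _ ≤ ∫⁻ ω, (∫⁻ l in Set.Ioi (0 : ℝ),
          ENNReal.ofReal ((1 - Real.exp (-(l * X ω))) * l ^ (-a - 1))) ∂P := by
        apply lintegral_mono_ae
        filter_upwards [hpos] with ω h
        exact ofReal_mul_rpow_le_lintegral_one_sub_exp ha h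
    _ = ∫⁻ l in Set.Ioi (0 : ℝ), ∫⁻ ω,
          ENNReal.ofReal ((1 - Real.exp (-(l * X ω))) * l ^ (-a - 1)) ∂P := by
        apply lintegral_lintegral_swap
        apply Measurable.aemeasurable
        fun_prop
    _ = ∫⁻ l in Set.Ioi (0 : ℝ),
          ENNReal.ofReal ((1 - Real.exp (-(l ^ b))) * l ^ (-a - 1)) := by
        apply setLIntegral_congr_fun measurableSet_Ioi
        intro l hl
        have hl0 : 0 < l := hl
        have hi := integrable_exp_neg_mul_of_pos hX hpos hl0
        have hi' : Integrable (fun ω => 1 - Real.exp (-(l * X ω))) P :=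
          (integrable_const 1).sub hi
        beta_reduce
        rw [← ofReal_integral_eq_lintegral_ofReal (hi'.mul_const _), integral_mul_const,
          integral_sub (integrable_const 1) hi, hlap l hl0]
        · simp
        · filter_upwards [hpos] with ω h
          have h1 : Real.exp (-(l * X ω)) ≤ 1 := by
            rw [Real.exp_le_one_iff]
            have : 0 < l * X ω := by positivity
            linarith
          exact mul_nonneg (by linarith) (by positivity)
    _ ≤ _ := lintegral_one_sub_exp_rpow_le ha.1 hab

lemma integrable_rpow_and_integral_le_of_stable (ha : a ∈ Set.Ioo (0 : ℝ) 1) (hab : a < b)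
    (hX : Measurable X) (hpos : ∀ᵐ ω ∂P, 0 < X ω)
    (hlap : ∀ l : ℝ, 0 < l → ∫ ω, Real.exp (-(l * X ω)) ∂P = Real.exp (-(l ^ b))) :
    Integrable (fun ω => X ω ^ a) P ∧
      ∫ ω, X ω ^ a ∂P ≤ (1 / (b - a) + 1 / a) / (1 / (1 - a) - 1 / 2) := by
  have h := ofReal_mul_lintegral_rpow_le_of_stable ha hab hX hpos hlap
  have hc : 0 < 1 / (1 - a) - 1 / 2 := by
    have : 1 ≤ 1 / (1 - a) := by
      rw [le_div_iff₀ (by linarith [ha.2])]; linarith [ha.1]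
    linarith
  have hnn : 0 ≤ᵐ[P] fun ω => X ω ^ a := by
    filter_upwards [hpos] with ω h
    exact Real.rpow_nonneg h.le _
  have hi : Integrable (fun ω => X ω ^ a) P := by
    refine ⟨(hX.pow_const a).aestronglyMeasurable, ?_⟩
    rw [hasFiniteIntegral_iff_ofReal hnn]
    by_contra! htop
    rw [top_le_iff.1 htop, ENNReal.mul_top (by simpa using hc)] at h
    exact absurd h (by simp)
  refine ⟨hi, ?_⟩
  rw [← ofReal_integral_eq_lintegral_ofReal hi hnn, ← ENNReal.ofReal_mul hc.le,
    ENNReal.ofReal_le_ofReal_iff] at h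
  · rwa [le_div_iff₀' hc]
  · have := sub_pos.2 hab
    have := ha.1
    positivity

lemma integral_sq_exp_neg_sub_of_stable (hX : Measurable X) (hpos : ∀ᵐ ω ∂P, 0 < X ω)
    (hlap : ∀ l : ℝ, 0 < l → ∫ ω, Real.exp (-(l * X ω)) ∂P = Real.exp (-(l ^ b))) :
    Integrable (fun ω => (Real.exp (-X ω) - Real.exp (-1)) ^ 2) P ∧
      ∫ ω, (Real.exp (-X ω) - Real.exp (-1)) ^ 2 ∂P =
        Real.exp (-((2 : ℝ) ^ b)) - Real.exp (-2) := by
  have i1 := integrable_exp_neg_mul_of_pos hX hpos one_pos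
  have i2 := integrable_exp_neg_mul_of_pos hX hpos two_pos
  have e : (fun ω => (Real.exp (-X ω) - Real.exp (-1)) ^ 2) = fun ω =>
      (Real.exp (-(2 * X ω)) - 2 * Real.exp (-1) * Real.exp (-(1 * X ω))) + Real.exp (-2) := by
    ext ω
    rw [show -(2 * X ω) = -X ω + -X ω by ring, show (-2 : ℝ) = -1 + -1 by norm_num,
      Real.exp_add, Real.exp_add, one_mul]
    ring
  have i3 : Integrable (fun ω => Real.exp (-(2 * X ω)) -
      2 * Real.exp (-1) * Real.exp (-(1 * X ω))) P := i2.sub (i1.const_mul _)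
  rw [e]
  refine ⟨i3.add (integrable_const _), ?_⟩
  rw [integral_add i3 (integrable_const _), integral_sub i2 (i1.const_mul _),
    integral_const_mul, hlap 1 one_pos, hlap 2 two_pos]
  have : Real.exp (-2) = Real.exp (-1) * Real.exp (-1) := by
    rw [← Real.exp_add]; norm_num
  simp [this]
  ring

end Stable

lemma exists_abs_sub_one_rpow_le {s : ℝ} (hs : s ∈ Set.Ioo (0 : ℝ) 1) :
    ∃ C : ℝ, ∀ a ∈ Set.Icc (1 / 2 : ℝ) 1, ∀ w : ℝ, 0 < w →
      |w - 1| ^ a ≤ w ^ a - 1 + 2 * s + C * (Real.exp (-w) - Real.exp (-1)) ^ 2 := by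
  obtain ⟨hs0, hs1⟩ := hs
  set d : ℝ := Real.exp (-1) * (1 - Real.exp (-s ^ 2)) with hd
  have hd0 : 0 < d := by
    have : Real.exp (-s ^ 2) < 1 := by
      rw [Real.exp_lt_one_iff]
      have : 0 < s ^ 2 := by positivity
      linarith
    have := sub_pos.2 this
    positivity
  refine ⟨2 / d ^ 2, ?_⟩
  rintro a ⟨ha, ha1⟩ w hw
  have hwa : 0 ≤ w ^ a := Real.rpow_nonneg hw.le _
  rcases lt_or_ge |w - 1| (s ^ 2) with h | h
  · have h1 : |w - 1| ^ a ≤ s := by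
      calc |w - 1| ^ a ≤ (s ^ 2) ^ a := by gcongr
        _ ≤ (s ^ 2) ^ (1 / 2 : ℝ) :=
            Real.rpow_le_rpow_of_exponent_ge (by positivity) (by nlinarith) ha
        _ = s := by rw [← Real.sqrt_eq_rpow, Real.sqrt_sq hs0.le]
    have h2 : 1 - s ≤ w ^ a := by
      rcases le_total w 1 with h' | h'
      · have : w ^ (1 : ℝ) ≤ w ^ a := Real.rpow_le_rpow_of_exponent_ge hw h' ha1
        rw [Real.rpow_one] at this
        have := (abs_lt.1 h).1
        nlinarith
      · have := Real.one_le_rpow h' (by linarith : 0 ≤ a)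
        linarith
    have h3 : 0 ≤ 2 / d ^ 2 * (Real.exp (-w) - Real.exp (-1)) ^ 2 := by positivity
    linarith
  · have h1 : d ≤ |Real.exp (-w) - Real.exp (-1)| := by
      rcases le_abs'.1 h with h' | h'
      · refine le_trans ?_ (le_abs_self _)
        have e : Real.exp (-1 + s ^ 2) ≤ Real.exp (-w) := Real.exp_le_exp.2 (by linarith)
        rw [Real.exp_add] at e
        have e1 := Real.add_one_le_exp (s ^ 2)
        have e2 := Real.add_one_le_exp (-s ^ 2)
        have e3 := Real.exp_pos (-1)
        nlinarith
      · refine le_trans ?_ (neg_le_abs _)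
        have e : Real.exp (-w) ≤ Real.exp (-1 + -s ^ 2) := Real.exp_le_exp.2 (by linarith)
        rw [Real.exp_add] at e
        linarith
    have h2 : 2 ≤ 2 / d ^ 2 * (Real.exp (-w) - Real.exp (-1)) ^ 2 := by
      rw [div_mul_eq_mul_div, le_div_iff₀ (by positivity), ← sq_abs (Real.exp (-w) - _)]
      gcongr
    have h3 : |w - 1| ^ a ≤ w ^ a + 1 := by
      rcases le_total w 1 with h' | h'
      · have : |w - 1| ^ a ≤ 1 :=
          Real.rpow_le_one (abs_nonneg _) (by rw [abs_le]; constructor <;> linarith) (by linarith)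
        linarith
      · have : |w - 1| ^ a ≤ w ^ a := by
          gcongr
          rw [abs_le]; constructor <;> linarith
        linarith
    linarith

lemma tendsto_one_of_one_sub_ratio_tendsto_zero {α : ℕ → ℝ}
    (hmem : ∀ k, α k ∈ Set.Ioo (0 : ℝ) 1)
    (hratio : Tendsto (fun k => (1 - α (k + 1)) / (1 - α k)) atTop (nhds 0)) :
    Tendsto α atTop (nhds 1) := by
  rw [← tendsto_add_atTop_iff_nat 1]
  have h : Tendsto (fun k => 1 - α (k + 1)) atTop (nhds 0) := by
    refine squeeze_zero (fun k => by linarith [(hmem (k + 1)).2]) (fun k => ?_) hratio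
    have h1 := hmem k
    have h2 := hmem (k + 1)
    rw [le_div_iff₀ (by linarith [h1.2])]
    nlinarith [h1.1, h2.2]
  simpa using h.const_sub 1

lemma tendsto_stable_moment_bound {α : ℕ → ℝ}
    (hmem : ∀ k, α k ∈ Set.Ioo (0 : ℝ) 1)
    (hratio : Tendsto (fun k => (1 - α (k + 1)) / (1 - α k)) atTop (nhds 0)) :
    Tendsto (fun k => (1 / (α (k + 1) - α k) + 1 / α k) / (1 / (1 - α k) - 1 / 2))
      atTop (nhds 1) := by
  have hα := tendsto_one_of_one_sub_ratio_tendsto_zero hmem hratio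
  have h1 : Tendsto (fun k => 1 - α k) atTop (nhds 0) := by simpa using hα.const_sub 1
  have h2 : Tendsto (fun k => (1 / (1 - (1 - α (k + 1)) / (1 - α k)) + (1 - α k) / α k) /
      (1 - (1 - α k) / 2)) atTop (nhds ((1 / (1 - 0) + 0 / 1) / (1 - 0 / 2))) :=
    ((tendsto_const_nhds.div (hratio.const_sub 1) (by norm_num)).add
      (h1.div hα (by norm_num))).div ((h1.div_const 2).const_sub 1) (by norm_num)
  norm_num at h2
  refine h2.congr fun k => ?_
  have h3 : 1 - α k ≠ 0 := by linarith [(hmem k).2]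
  have e1 : 1 - (1 - α (k + 1)) / (1 - α k) = (α (k + 1) - α k) / (1 - α k) := by
    field_simp; ring
  rw [e1, inv_div,
    ← mul_div_mul_left (1 / (α (k + 1) - α k) + 1 / α k) _ h3]
  congr 1
  · ring
  · field_simp

/-- let `(α_k)` be strictly increasing in `(0,1)` with
`(1-α_{k+1})/(1-α_k) → 0`, and for each `k` let `W_k` be a positive random variable with
Laplace transform `E[e^{-λ W_k}] = exp{-λ^{α_{k+1}}}` (an `α_{k+1}`-stable variable).
Then `E[|W_k - 1|^{α_k}] → 0` as `k → ∞`. -/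
theorem moment_W_sub_one_tendsto_zero {Ω : Type*} [MeasurableSpace Ω] (P : Measure Ω)
    [IsProbabilityMeasure P] (α : ℕ → ℝ)
    (hmem : ∀ k, α k ∈ Set.Ioo (0 : ℝ) 1) (hmono : StrictMono α)
    (hratio : Tendsto (fun k => (1 - α (k + 1)) / (1 - α k)) atTop (nhds 0))
    (W : ℕ → Ω → ℝ) (hWmeas : ∀ k, Measurable (W k))
    (hWpos : ∀ k, ∀ᵐ ω ∂P, 0 < W k ω)
    (hlaplace : ∀ k, ∀ l : ℝ, 0 < l →
      ∫ ω, Real.exp (-(l * W k ω)) ∂P = Real.exp (-(l ^ α (k + 1)))) :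
    Tendsto (fun k => ∫⁻ ω, ENNReal.ofReal (|W k ω - 1| ^ α k) ∂P) atTop (nhds 0) := by
  have hα := tendsto_one_of_one_sub_ratio_tendsto_zero hmem hratio
  have hM := tendsto_stable_moment_bound hmem hratio
  have hD : Tendsto (fun k => Real.exp (-((2 : ℝ) ^ α (k + 1))) - Real.exp (-2)) atTop
      (nhds 0) := by
    have h1 : Tendsto (fun k => (2 : ℝ) ^ α (k + 1)) atTop (nhds ((2 : ℝ) ^ (1 : ℝ))) :=
      tendsto_const_nhds.rpow ((tendsto_add_atTop_iff_nat 1).2 hα) (Or.inl two_ne_zero)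
    rw [Real.rpow_one] at h1
    simpa using (h1.neg.rexp).sub_const (Real.exp (-2))
  rw [ENNReal.tendsto_nhds_zero]
  intro ε hε
  obtain ⟨e, he0, heε⟩ : ∃ e : ℝ, 0 < e ∧ ENNReal.ofReal e ≤ ε := by
    obtain ⟨e, he0, he⟩ := ENNReal.lt_iff_exists_nnreal_btwn.1 hε
    exact ⟨e, by exact_mod_cast he0, by simpa using he.le⟩
  set s : ℝ := min (e / 4) (1 / 2) with hs
  have hs0 : 0 < s := by positivity
  have hs1 : s < 1 := (min_le_right _ _).trans_lt (by norm_num)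
  have hse : s ≤ e / 4 := min_le_left _ _
  obtain ⟨C, hC⟩ := exists_abs_sub_one_rpow_le ⟨hs0, hs1⟩
  have hlim := ((hM.sub_const 1).add_const (2 * s)).add (hD.const_mul C)
  have hev := hlim.eventually_lt_const (u := e) (by linarith)
  filter_upwards [hev, hα.eventually_const_le (show (1 / 2 : ℝ) < 1 by norm_num)] with k hk hk'
  obtain ⟨i1, m1⟩ := integrable_rpow_and_integral_le_of_stable (hmem k) (hmono k.lt_succ_self)
    (hWmeas k) (hWpos k) (hlaplace k)
  obtain ⟨i2, m2⟩ := integral_sq_exp_neg_sub_of_stable (hWmeas k) (hWpos k) (hlaplace k)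
  have i3 : Integrable (fun ω => W k ω ^ α k - 1) P := i1.sub (integrable_const _)
  have i4 : Integrable (fun ω => W k ω ^ α k - 1 + 2 * s) P := i3.add (integrable_const _)
  have i5 : Integrable (fun ω => C * (Real.exp (-W k ω) - Real.exp (-1)) ^ 2) P :=
    i2.const_mul C
  have i6 : Integrable (fun ω => W k ω ^ α k - 1 + 2 * s +
      C * (Real.exp (-W k ω) - Real.exp (-1)) ^ 2) P := i4.add i5
  have hbound : ∀ᵐ ω ∂P, |W k ω - 1| ^ α k ≤
      W k ω ^ α k - 1 + 2 * s + C * (Real.exp (-W k ω) - Real.exp (-1)) ^ 2 := by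
    filter_upwards [hWpos k] with ω h
    exact hC _ ⟨hk', (hmem k).2.le⟩ _ h
  calc ∫⁻ ω, ENNReal.ofReal (|W k ω - 1| ^ α k) ∂P
      ≤ ∫⁻ ω, ENNReal.ofReal (W k ω ^ α k - 1 + 2 * s +
          C * (Real.exp (-W k ω) - Real.exp (-1)) ^ 2) ∂P := by
        apply lintegral_mono_ae
        filter_upwards [hbound] with ω h
        gcongr
    _ = ENNReal.ofReal (∫ ω, (W k ω ^ α k - 1 + 2 * s +
          C * (Real.exp (-W k ω) - Real.exp (-1)) ^ 2) ∂P) := by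
        rw [ofReal_integral_eq_lintegral_ofReal i6]
        filter_upwards [hbound] with ω h
        exact le_trans (by positivity) h
    _ ≤ ENNReal.ofReal e := by
        gcongr
        rw [integral_add i4 i5, integral_add i3 (integrable_const _),
          integral_sub i1 (integrable_const _), integral_const_mul C, m2]
        simp only [integral_const, probReal_univ, one_smul]
        linarith
    _ ≤ ε := heε

end
end
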